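/- Let R be a commutative ring and I ⊆ R a nilpotent ideal. Let X be a scheme over Spec R such that the closed subscheme Y = X ×_{Spec R} Spec(R/I) is affine and of finite type over R/I. Then X is affine and of finite type over R; that is, X is isomorphic over R to Spec A for a finite-type R-algebra A. -/

import Mathlib

open AlgebraicGeometry CategoryTheory CategoryTheory.Limits

/-- If `R → A → B` is of finite type, `A → B` is surjective and its kernel is generated by a
nilpotent ideal of `R`, then `R → A` is of finite type. -/
theorem RingHom.FiniteType.of_comp_of_ker_le_map {R A B : Type*} [CommRing R] [CommRing A]
    [CommRing B] {φ : R →+* A} {ψ : A →+* B} (hψ : Function.Surjective ψ) {I : Ideal R}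
    (hI : IsNilpotent I) (hker : RingHom.ker ψ ≤ I.map φ) (hft : (ψ.comp φ).FiniteType) :
    φ.FiniteType := by
  algebraize [φ, ψ, ψ.comp φ]
  obtain ⟨n, hn⟩ := hI
  obtain ⟨s, hs⟩ := Algebra.FiniteType.out (R := R) (A := B)
  choose g hg using hψ
  classical
  refine ⟨s.image g, ?_⟩
  set A₀ := Algebra.adjoin R ((s.image g : Finset A) : Set A) with hA₀
  have hmap : ∀ b : B, ∃ a ∈ A₀, ψ a = b := by
    intro b
    have hb : b ∈ Algebra.adjoin R (s : Set B) := hs ▸ Algebra.mem_top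
    have : Algebra.adjoin R (s : Set B) ≤ A₀.map (IsScalarTower.toAlgHom R A B) := by
      rw [Algebra.adjoin_le_iff]
      intro x hx
      exact ⟨g x, Algebra.subset_adjoin (by simpa using ⟨x, hx, rfl⟩), hg x⟩
    obtain ⟨a, ha, rfl⟩ := this hb
    exact ⟨a, ha, rfl⟩
  have hstep : (⊤ : Submodule R A) ≤ Subalgebra.toSubmodule A₀ ⊔ I • ⊤ := by
    intro a _
    obtain ⟨a', ha', h⟩ := hmap (ψ a)
    have : a - a' ∈ I.map φ := hker (by simp [RingHom.mem_ker, h])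
    rw [← add_sub_cancel a' a]
    refine Submodule.add_mem_sup ha' ?_
    rw [Ideal.smul_top_eq_map]
    exact this
  have hpow : ∀ m : ℕ, (⊤ : Submodule R A) ≤ Subalgebra.toSubmodule A₀ ⊔ I ^ m • ⊤ := by
    intro m
    induction m with
    | zero =>
      rw [pow_zero, Ideal.one_eq_top, Submodule.top_smul]
      exact le_sup_right
    | succ m ih =>
      refine hstep.trans (sup_le le_sup_left ?_)
      refine (smul_mono_right I ih).trans ?_
      rw [Submodule.smul_sup, ← mul_smul, ← pow_succ']
      exact sup_le_sup_right Submodule.smul_le_right _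
  refine top_le_iff.mp fun a _ ↦ ?_
  have := hpow n (Submodule.mem_top (x := a))
  rw [hn] at this
  simpa using this

namespace AlgebraicGeometry

open TopologicalSpace Filter

universe u

variable {X Y : Scheme.{u}}

/-- Restriction of sections of a scheme, as a ring homomorphism. -/
noncomputable def Scheme.resHom (X : Scheme.{u}) {U V : X.Opens} (h : V ≤ U) :
    Γ(X, U) →+* Γ(X, V) :=
  (X.presheaf.map (homOfLE h).op).hom

namespace Scheme

@[simp]
lemma resHom_resHom {U V W : X.Opens} (h : V ≤ U) (h' : W ≤ V) (a : Γ(X, U)) :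
    X.resHom h' (X.resHom h a) = X.resHom (h'.trans h) a := by
  simp only [resHom, ← CommRingCat.comp_apply, ← Functor.map_comp]
  rfl

@[simp]
lemma basicOpen_resHom {U V : X.Opens} (h : V ≤ U) (a : Γ(X, U)) :
    X.basicOpen (X.resHom h a) = V ⊓ X.basicOpen a :=
  X.basicOpen_res a (homOfLE h).op

lemma Hom.app_resHom (i : Y ⟶ X) {U V : X.Opens} (h : V ≤ U) (a : Γ(X, U)) :
    i.app V (X.resHom h a) = Y.resHom (i.preimage_mono h) (i.app U a) := by
  simp only [resHom, ← CommRingCat.comp_apply]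
  rw [i.naturality]
  rfl

lemma eq_of_resHom_eq {ι : Type*} {U : ι → X.Opens} {W : X.Opens} (h : ∀ j, U j ≤ W)
    (hW : W ≤ iSup U) {s t : Γ(X, W)} (hst : ∀ j, X.resHom (h j) s = X.resHom (h j) t) :
    s = t :=
  X.sheaf.eq_of_locally_eq' U W (fun j ↦ homOfLE (h j)) hW s t hst

lemma exists_resHom_eq {ι : Type*} {U : ι → X.Opens} {W : X.Opens} (h : ∀ j, U j ≤ W)
    (hW : W ≤ iSup U) (s : ∀ j, Γ(X, U j))
    (hs : ∀ j l, X.resHom (inf_le_left : U j ⊓ U l ≤ U j) (s j) =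
      X.resHom (inf_le_right : U j ⊓ U l ≤ U l) (s l)) :
    ∃ t : Γ(X, W), ∀ j, X.resHom (h j) t = s j :=
  (X.sheaf.existsUnique_gluing' U W (fun j ↦ homOfLE (h j)) hW s hs).exists

lemma Hom.preimage_injective (i : Y ⟶ X) [Surjective i] :
    Function.Injective fun U : X.Opens ↦ i ⁻¹ᵁ U :=
  fun _ _ h ↦ Opens.ext (Set.preimage_injective.mpr i.surjective
    (congr_arg (fun U : Y.Opens ↦ (U : Set Y)) h))

end Scheme

namespace IsAffineOpen

lemma eventually_pow_mul_eq_zero {U V : X.Opens} (hU : IsAffineOpen U) {F : Γ(X, U)}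
    (hVU : V ≤ U) (hV : V = X.basicOpen F) {x : Γ(X, U)} (hx : X.resHom hVU x = 0) :
    ∀ᶠ n in atTop, F ^ n * x = 0 := by
  subst hV
  obtain ⟨n, hn⟩ := exists_pow_mul_eq_zero_of_res_basicOpen_eq_zero_of_isAffineOpen X hU x F hx
  filter_upwards [eventually_ge_atTop n] with m hm
  rw [← Nat.sub_add_cancel hm, pow_add, mul_assoc, hn, mul_zero]

lemma eventually_exists_resHom_eq_pow_mul {U V : X.Opens} (hU : IsAffineOpen U) (F : Γ(X, U))
    (hVU : V ≤ U) (hV : V = X.basicOpen F) (x : Γ(X, V)) :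
    ∀ᶠ n in atTop, ∃ y : Γ(X, U), X.resHom hVU y = X.resHom hVU F ^ n * x := by
  subst hV
  obtain ⟨n, y, hy⟩ := exists_eq_pow_mul_of_isAffineOpen X U hU F x
  replace hy : X.resHom hVU y = X.resHom hVU F ^ n * x := hy
  filter_upwards [eventually_ge_atTop n] with m hm
  refine ⟨F ^ (m - n) * y, ?_⟩
  rw [map_mul, map_pow, hy, ← mul_assoc, ← pow_add, Nat.sub_add_cancel hm]

/-- Up to multiplication by a power of `F`, a section over `D(F)` vanishing on a closed
subscheme extends to a section vanishing on the closed subscheme. -/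
lemma eventually_exists_app_eq_zero_and_resHom_eq_pow_mul (i : Y ⟶ X) [IsAffineHom i]
    {U V : X.Opens} (hU : IsAffineOpen U) (F : Γ(X, U)) (hVU : V ≤ U) (hV : V = X.basicOpen F)
    (x : Γ(X, V)) (hx : i.app V x = 0) :
    ∀ᶠ n in atTop, ∃ y : Γ(X, U), i.app U y = 0 ∧ X.resHom hVU y = X.resHom hVU F ^ n * x := by
  obtain ⟨n, y, hy⟩ := (hU.eventually_exists_resHom_eq_pow_mul F hVU hV x).exists
  have hzero : Y.resHom (i.preimage_mono hVU) (i.app U y) = 0 := by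
    rw [← i.app_resHom hVU, hy, map_mul, hx, mul_zero]
  obtain ⟨m, hm⟩ := ((hU.preimage i).eventually_pow_mul_eq_zero (F := i.app U F)
    (i.preimage_mono hVU) (hV ▸ i.preimage_basicOpen F) hzero).exists
  filter_upwards [eventually_ge_atTop (m + n)] with k hk
  obtain ⟨k, rfl⟩ := Nat.exists_eq_add_of_le hk
  refine ⟨F ^ (k + m) * y, ?_, ?_⟩
  · rw [map_mul, map_pow, pow_add, mul_assoc, hm, mul_zero]
  · rw [map_mul, map_pow, hy]
    ring

end IsAffineOpen

/-- For every affine open `U`, the kernel of `Γ(X, U) ⟶ Γ(Y, i⁻¹ U)` has square zero. -/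
def SquareZeroKer (i : Y ⟶ X) : Prop :=
  ∀ U : X.Opens, IsAffineOpen U → ∀ a b : Γ(X, U), i.app U a = 0 → i.app U b = 0 → a * b = 0

namespace SquareZeroKer

variable {i : Y ⟶ X} (hi : SquareZeroKer i)

include hi in
lemma mul_eq_mul {U : X.Opens} (hU : IsAffineOpen U) {a a' c : Γ(X, U)}
    (h : i.app U a = i.app U a') (hc : i.app U c = 0) : a * c = a' * c := by
  rw [← sub_eq_zero, ← sub_mul]
  exact hi U hU _ _ (by rw [map_sub, h, sub_self]) hc

variable [IsClosedImmersion i]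

/-- The ideal of those global sections of `Y` which turn the Čech `1`-cocycle `gⱼ - gₗ` into a
coboundary. -/
def coboundaryIdeal {ι : Type*} {U : ι → X.Opens} (hU : ∀ j, IsAffineOpen (U j))
    (hUU : ∀ j l, IsAffineOpen (U j ⊓ U l)) (g : ∀ j, Γ(X, U j))
    (hg : ∀ j l, i.app _ (X.resHom (inf_le_left : U j ⊓ U l ≤ U j) (g j)) =
      i.app _ (X.resHom (inf_le_right : U j ⊓ U l ≤ U l) (g l))) : Ideal Γ(Y, ⊤) where
  carrier := {t | ∃ h : ∀ j, Γ(X, U j), (∀ j, i.app (U j) (h j) = 0) ∧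
    ∀ j l, ∀ a : Γ(X, U j ⊓ U l), i.app _ a = Y.resHom le_top t →
      X.resHom inf_le_left (h j) - X.resHom inf_le_right (h l) =
        a * (X.resHom inf_le_left (g j) - X.resHom inf_le_right (g l))}
  zero_mem' := by
    refine ⟨0, fun j ↦ map_zero _, fun j l a ha ↦ ?_⟩
    rw [map_zero] at ha
    rw [hi _ (hUU j l) _ _ ha (by rw [map_sub, hg, sub_self])]
    simp
  add_mem' := by
    rintro t t' ⟨h, h0, hh⟩ ⟨h', h0', hh'⟩
    refine ⟨h + h', fun j ↦ by simp [h0, h0'], fun j l a ha ↦ ?_⟩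
    obtain ⟨a₁, ha₁⟩ := i.app_surjective _ (hUU j l) (Y.resHom le_top t)
    have e := hh j l a₁ ha₁
    have e' := hh' j l (a - a₁) (by rw [map_sub, ha, ha₁, map_add, add_sub_cancel_left])
    simp only [Pi.add_apply, map_add]
    linear_combination e + e'
  smul_mem' := by
    rintro b t ⟨h, h0, hh⟩
    choose β hβ using fun j ↦ i.app_surjective _ (hU j) (Y.resHom le_top b)
    refine ⟨β * h, fun j ↦ by simp [h0], fun j l a ha ↦ ?_⟩
    obtain ⟨a₁, ha₁⟩ := i.app_surjective _ (hUU j l) (Y.resHom le_top t)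
    have e := hh j l a₁ ha₁
    have hβl : X.resHom (inf_le_right : U j ⊓ U l ≤ U l) (β l) * X.resHom inf_le_right (h l) =
        X.resHom inf_le_left (β j) * X.resHom inf_le_right (h l) := by
      refine hi.mul_eq_mul (hUU j l) ?_ ?_
      · simp [Scheme.Hom.app_resHom, hβ]
      · simp [Scheme.Hom.app_resHom, h0]
    have ha' : a * (X.resHom (inf_le_left : U j ⊓ U l ≤ U j) (g j) - X.resHom inf_le_right (g l)) =
        (X.resHom inf_le_left (β j) * a₁) *
          (X.resHom inf_le_left (g j) - X.resHom inf_le_right (g l)) := by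
      refine hi.mul_eq_mul (hUU j l) ?_ ?_
      · simp [Scheme.Hom.app_resHom, hβ, ha, ha₁]
      · rw [map_sub, hg, sub_self]
    rw [ha']
    simp only [Pi.mul_apply, map_mul, hβl]
    linear_combination X.resHom inf_le_left (β j) * e

lemma coboundaryIdeal_eq_top [Surjective i] {ι : Type*} [Finite ι] {U : ι → X.Opens}
    (hU : ∀ j, IsAffineOpen (U j)) (hUU : ∀ j l, IsAffineOpen (U j ⊓ U l)) (g : ∀ j, Γ(X, U j))
    (hg : ∀ j l, i.app _ (X.resHom (inf_le_left : U j ⊓ U l ≤ U j) (g j)) =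
      i.app _ (X.resHom (inf_le_right : U j ⊓ U l ≤ U l) (g l)))
    (f : ι → Γ(Y, ⊤)) (hf : ∀ k, i ⁻¹ᵁ U k = Y.basicOpen (f k))
    (hspan : Ideal.span (Set.range f) = ⊤) :
    hi.coboundaryIdeal hU hUU g hg = ⊤ := by
  rw [← Ideal.radical_eq_top, ← top_le_iff, ← hspan, Ideal.span_le]
  rintro _ ⟨k, rfl⟩
  choose F hF using fun j ↦ i.app_surjective _ (hU j) (Y.resHom le_top (f k))
  have hV (j) : U j ⊓ U k = X.basicOpen (F j) := by
    refine i.preimage_injective ?_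
    change i ⁻¹ᵁ (U j ⊓ U k) = i ⁻¹ᵁ X.basicOpen (F j)
    rw [i.preimage_inf, i.preimage_basicOpen, hF, Y.basicOpen_resHom, hf k]
  have hVV (j l) : U j ⊓ U l ⊓ U k =
      X.basicOpen (X.resHom inf_le_left (F j) : Γ(X, U j ⊓ U l)) := by
    rw [X.basicOpen_resHom, ← hV]
    exact le_antisymm (le_inf inf_le_left (inf_le_inf_right _ inf_le_left))
      (inf_le_inf_left _ inf_le_right)
  have hW (j l) : IsAffineOpen (U j ⊓ U l ⊓ U k) := hVV j l ▸ (hUU j l).basicOpen _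
  obtain ⟨n, hn⟩ := (eventually_all.mpr fun j ↦
    (hU j).eventually_exists_app_eq_zero_and_resHom_eq_pow_mul i (F j) inf_le_left (hV j)
      (X.resHom inf_le_left (g j) - X.resHom inf_le_right (g k))
      (by rw [map_sub, hg, sub_self])).exists
  choose y hy0 hy using hn
  have hzero (j l) : X.resHom (inf_le_left : U j ⊓ U l ⊓ U k ≤ U j ⊓ U l)
      (X.resHom inf_le_left (y j) - X.resHom inf_le_right (y l) -
        X.resHom inf_le_left (F j) ^ n *
          (X.resHom inf_le_left (g j) - X.resHom inf_le_right (g l))) = 0 := by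
    have hj := congr(X.resHom (inf_le_inf_right _ inf_le_left :
      U j ⊓ U l ⊓ U k ≤ U j ⊓ U k) $(hy j))
    have hl := congr(X.resHom (inf_le_inf_right _ inf_le_right :
      U j ⊓ U l ⊓ U k ≤ U l ⊓ U k) $(hy l))
    have hc := congr(Y.resHom (i.preimage_mono (inf_le_inf_right _ inf_le_right :
      U j ⊓ U l ⊓ U k ≤ U l ⊓ U k)) $(hg l k))
    rw [← i.app_resHom (inf_le_inf_right _ inf_le_right : U j ⊓ U l ⊓ U k ≤ U l ⊓ U k),
      ← i.app_resHom (inf_le_inf_right _ inf_le_right : U j ⊓ U l ⊓ U k ≤ U l ⊓ U k)] at hc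
    have hF' : X.resHom (inf_le_left.trans inf_le_right : U j ⊓ U l ⊓ U k ≤ U l) (F l) ^ n *
          (X.resHom (inf_le_left.trans inf_le_right) (g l) - X.resHom inf_le_right (g k)) =
        X.resHom (inf_le_left.trans inf_le_left) (F j) ^ n *
          (X.resHom (inf_le_left.trans inf_le_right) (g l) - X.resHom inf_le_right (g k)) := by
      refine hi.mul_eq_mul (hW j l) ?_ ?_
      · simp [Scheme.Hom.app_resHom, hF]
      · simpa [sub_eq_zero] using hc
    simp only [map_sub, map_mul, map_pow, Scheme.resHom_resHom] at hj hl hF' ⊢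
    linear_combination hj - hl - hF'
  obtain ⟨m, hm⟩ := (eventually_all.mpr fun j ↦ eventually_all.mpr fun l ↦
    (hUU j l).eventually_pow_mul_eq_zero inf_le_left (hVV j l) (hzero j l)).exists
  refine ⟨m + n, fun j ↦ F j ^ m * y j, fun j ↦ by simp [hy0], fun j l a ha ↦ ?_⟩
  have hFl : X.resHom (inf_le_right : U j ⊓ U l ≤ U l) (F l) ^ m * X.resHom inf_le_right (y l) =
      X.resHom inf_le_left (F j) ^ m * X.resHom inf_le_right (y l) := by
    refine hi.mul_eq_mul (hUU j l) ?_ ?_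
    · simp [Scheme.Hom.app_resHom, hF]
    · simp [Scheme.Hom.app_resHom, hy0]
  have ha' : a * (X.resHom (inf_le_left : U j ⊓ U l ≤ U j) (g j) - X.resHom inf_le_right (g l)) =
      X.resHom inf_le_left (F j) ^ (m + n) *
        (X.resHom inf_le_left (g j) - X.resHom inf_le_right (g l)) := by
    refine hi.mul_eq_mul (hUU j l) ?_ ?_
    · simp [Scheme.Hom.app_resHom, hF, ha]
    · rw [map_sub, hg, sub_self]
  rw [ha']
  simp only [map_mul, map_pow, hFl]
  linear_combination hm j l

lemma span_basicOpen_eq_top [Surjective i] [IsAffine Y] :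
    Ideal.span {f : Γ(Y, ⊤) | ∃ U : X.Opens, IsAffineOpen U ∧ i ⁻¹ᵁ U = Y.basicOpen f} = ⊤ := by
  rw [← (isAffineOpen_top Y).iSup_basicOpen_eq_self_iff, eq_top_iff]
  intro x _
  obtain ⟨_, ⟨V, hV, rfl⟩, hxV, -⟩ :=
    X.isBasis_affineOpens.exists_subset_of_mem_open (Set.mem_univ (i x)) isOpen_univ
  obtain ⟨_, ⟨_, ⟨f, rfl⟩, rfl⟩, hxf, hfV⟩ :=
    (isBasis_basicOpen Y).exists_subset_of_mem_open hxV (i ⁻¹ᵁ V).isOpen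
  obtain ⟨F, hF⟩ := i.app_surjective V hV (Y.resHom le_top f)
  refine Opens.mem_iSup.mpr ⟨⟨f, X.basicOpen F, hV.basicOpen F, ?_⟩, hxf⟩
  rw [i.preimage_basicOpen, hF, Y.basicOpen_resHom]
  exact inf_eq_right.mpr hfV

include hi in
/-- If `Y` is affine, then every global section of `Y` lifts to `X`. -/
lemma appTop_surjective [Surjective i] [IsAffine Y] : Function.Surjective i.appTop := by
  intro b
  obtain ⟨s, hs, hspan⟩ := (Ideal.span_eq_top_iff_finite _).mp (span_basicOpen_eq_top (i := i))
  choose U hU hf using fun f : s ↦ hs f.2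
  have hpre (j l : s) : i ⁻¹ᵁ (U j ⊓ U l) = i ⁻¹ᵁ U j ⊓ Y.basicOpen l.1 := by
    rw [i.preimage_inf, hf l]
  have hUU (j l : s) : IsAffineOpen (U j ⊓ U l) := by
    obtain ⟨F, hF⟩ := i.app_surjective _ (hU j) (Y.resHom le_top l.1)
    have : U j ⊓ U l = X.basicOpen F := i.preimage_injective <| by
      change i ⁻¹ᵁ (U j ⊓ U l) = i ⁻¹ᵁ X.basicOpen F
      rw [i.preimage_basicOpen, hF, Y.basicOpen_resHom, hpre]
    exact this ▸ (hU j).basicOpen F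
  choose g hgb using fun j : s ↦ i.app_surjective _ (hU j) (Y.resHom le_top b)
  have hg (j l : s) : i.app _ (X.resHom (inf_le_left : U j ⊓ U l ≤ U j) (g j)) =
      i.app _ (X.resHom (inf_le_right : U j ⊓ U l ≤ U l) (g l)) := by
    simp [Scheme.Hom.app_resHom, hgb]
  have htop := hi.coboundaryIdeal_eq_top hU hUU g hg Subtype.val
    hf (by simpa using hspan)
  obtain ⟨h, h0, hh⟩ := (Ideal.eq_top_iff_one _).mp htop
  have hYcov : ⨆ j : s, Y.basicOpen j.1 = ⊤ :=
    ((isAffineOpen_top Y).iSup_basicOpen_eq_self_iff (s := (s : Set Γ(Y, ⊤)))).mpr hspan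
  have hcov : ⊤ ≤ ⨆ j, i ⁻¹ᵁ U j :=
    hYcov.ge.trans (iSup_mono fun j ↦ (hf j).ge)
  have hXcov : ⊤ ≤ ⨆ j, U j := by
    refine (i.preimage_injective ?_).ge
    change i ⁻¹ᵁ _ = ⊤
    rw [i.preimage_iSup]
    exact top_le_iff.mp hcov
  obtain ⟨G, hG⟩ := Scheme.exists_resHom_eq (fun j : s ↦ le_top) hXcov (fun j ↦ g j - h j) <| by
    intro j l
    have := hh j l 1 (by simp)
    simp only [map_sub]
    linear_combination -this
  refine ⟨G, Scheme.eq_of_resHom_eq (fun j : s ↦ le_top) hcov fun j ↦ ?_⟩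
  have := congr(i.app _ $(hG j))
  rwa [Scheme.Hom.app_resHom, map_sub, h0, sub_zero, hgb] at this

include hi in
/-- If `Y` is affine, then so is `X`. -/
theorem isAffine [Surjective i] [IsAffine Y] : IsAffine X := by
  refine isAffine_of_isAffineOpen_basicOpen {a : Γ(X, ⊤) | IsAffineOpen (X.basicOpen a)} ?_
    fun _ h ↦ h
  have hsurj := hi.appTop_surjective
  have hle : Ideal.span {f : Γ(Y, ⊤) | ∃ U : X.Opens, IsAffineOpen U ∧ i ⁻¹ᵁ U = Y.basicOpen f} ≤
      (Ideal.span {a : Γ(X, ⊤) | IsAffineOpen (X.basicOpen a)}).map i.appTop.hom := by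
    rw [Ideal.span_le]
    rintro f ⟨U, hU, hf⟩
    obtain ⟨a, rfl⟩ := hsurj f
    refine Ideal.mem_map_of_mem _ (Ideal.subset_span ?_)
    have : X.basicOpen a = U :=
      i.preimage_injective (by exact (i.preimage_basicOpen a).trans hf.symm)
    rwa [Set.mem_ofPred_eq, this]
  rw [span_basicOpen_eq_top, top_le_iff, Ideal.eq_top_iff_one,
    Ideal.mem_map_iff_of_surjective _ hsurj] at hle
  obtain ⟨a, ha, h1⟩ := hle
  refine Ideal.eq_top_of_isUnit_mem _ ha ?_
  have : X.basicOpen a = ⊤ := i.preimage_injective <| by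
    refine (i.preimage_basicOpen a).trans ?_
    change Y.basicOpen (i.appTop.hom a) = ⊤
    rw [h1]
    exact Y.basicOpen_of_isUnit isUnit_one
  refine X.toRingedSpace.isUnit_of_isUnit_germ _ _ fun x hx ↦ ?_
  rw [← this] at hx
  exact (X.mem_basicOpen _ _ _).mp hx

end SquareZeroKer

lemma IsAffineOpen.fromSpec_appLE_top {U : X.Opens} (hU : IsAffineOpen U) :
    hU.fromSpec.appLE U ⊤ hU.fromSpec_preimage_self.ge = (Scheme.ΓSpecIso Γ(X, U)).inv := by
  rw [Scheme.Hom.appLE, hU.fromSpec_app_self, Category.assoc, ← Functor.map_comp]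
  exact (congr_arg _ ((Spec _).presheaf.map_id _)).trans (Category.comp_id _)

lemma IsAffineOpen.ker_app_le_map {R : CommRingCat.{u}} {I : Ideal R}
    {f : X ⟶ Spec R} {i : Y ⟶ X} {g : Y ⟶ Spec (.of (R ⧸ I))}
    (h : IsPullback i g f (Spec.map (CommRingCat.ofHom (Ideal.Quotient.mk I))))
    {U : X.Opens} (hU : IsAffineOpen U) {φ : R ⟶ Γ(X, U)} (hφ : hU.fromSpec ≫ f = Spec.map φ) :
    RingHom.ker (i.app U).hom ≤ I.map φ.hom := by
  intro a ha
  let q := CommRingCat.ofHom (Ideal.Quotient.mk (I.map φ.hom))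
  have hlift : φ ≫ q = CommRingCat.ofHom (Ideal.Quotient.mk I) ≫
      CommRingCat.ofHom (Ideal.quotientMap _ φ.hom Ideal.le_comap_map) := by
    ext x
    simp [q]
  have hw : (Spec.map q ≫ hU.fromSpec) ≫ f =
      Spec.map (CommRingCat.ofHom (Ideal.quotientMap _ φ.hom Ideal.le_comap_map)) ≫
        Spec.map (CommRingCat.ofHom (Ideal.Quotient.mk I)) := by
    rw [← Spec.map_comp, ← hlift, Spec.map_comp, Category.assoc, hφ]
  have he : ⊤ ≤ (Spec.map q ≫ hU.fromSpec) ⁻¹ᵁ U := by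
    rw [Scheme.Hom.comp_preimage, hU.fromSpec_preimage_self]
    exact le_rfl
  have hzero : (Spec.map q ≫ hU.fromSpec).appLE U ⊤ he a = 0 := by
    obtain ⟨l, hl⟩ : ∃ l, l ≫ i = Spec.map q ≫ hU.fromSpec := ⟨_, h.lift_fst _ _ hw⟩
    revert he
    rw [← hl]
    intro he
    rw [Scheme.Hom.comp_appLE, CommRingCat.comp_apply]
    exact (congr_arg _ ha).trans (map_zero _)
  have happ : (Spec.map q ≫ hU.fromSpec).appLE U ⊤ he = q ≫ (Scheme.ΓSpecIso _).inv := by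
    rw [← Scheme.Hom.appLE_comp_appLE _ _ _ ⊤ _ hU.fromSpec_preimage_self.ge le_top,
      hU.fromSpec_appLE_top, Scheme.ΓSpecIso_inv_naturality]
    exact congr_arg _ (Scheme.Hom.appLE_eq_app _)
  rw [happ, CommRingCat.comp_apply] at hzero
  have hqa : q a = 0 := by
    simpa using congr((Scheme.ΓSpecIso _).hom $hzero)
  exact Ideal.Quotient.eq_zero_iff_mem.mp hqa

lemma surjective_SpecMap_quotientMk {R : CommRingCat.{u}} {I : Ideal R} (hI : IsNilpotent I) :
    Surjective (Spec.map (CommRingCat.ofHom (Ideal.Quotient.mk I))) := by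
  obtain ⟨n, hn⟩ := hI
  refine ⟨fun x ↦ ?_⟩
  have hx : I ≤ x.asIdeal := x.isPrime.le_of_pow_le (n := n) (by rw [hn]; exact bot_le)
  have : x ∈ Set.range (PrimeSpectrum.comap (Ideal.Quotient.mk I)) := by
    rw [range_comap_of_surjective _ _ Ideal.Quotient.mk_surjective]
    rwa [Ideal.mk_ker]
  exact this

lemma isAffine_of_isPullback_of_sq_eq_bot {R : CommRingCat.{u}} {I : Ideal R}
    (hI : I ^ 2 = ⊥) {f : X ⟶ Spec R} {i : Y ⟶ X} {g : Y ⟶ Spec (.of (R ⧸ I))}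
    (h : IsPullback i g f (Spec.map (CommRingCat.ofHom (Ideal.Quotient.mk I)))) [IsAffine Y] :
    IsAffine X := by
  have : IsClosedImmersion (Spec.map (CommRingCat.ofHom (Ideal.Quotient.mk I))) :=
    .spec_of_surjective _ Ideal.Quotient.mk_surjective
  have : IsClosedImmersion i := MorphismProperty.of_isPullback h.flip this
  have : Surjective i :=
    MorphismProperty.of_isPullback h.flip (surjective_SpecMap_quotientMk ⟨2, hI⟩)
  refine SquareZeroKer.isAffine (i := i) fun U hU a b ha hb ↦ ?_
  have := Ideal.mul_mem_mul (hU.ker_app_le_map h (Spec.map_preimage _).symm ha)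
    (hU.ker_app_le_map h (Spec.map_preimage _).symm hb)
  rwa [← Ideal.map_mul, ← pow_two, hI, Ideal.map_bot] at this

/-- A scheme over `Spec R` is affine if its restriction to a closed subscheme of `Spec R` defined
by a nilpotent ideal is. -/
theorem isAffine_of_isPullback_of_isNilpotent {R : Type u} [CommRing R] {I : Ideal R}
    (hI : IsNilpotent I) {f : X ⟶ Spec (.of R)} {i : Y ⟶ X}
    {g : Y ⟶ Spec (.of (R ⧸ I))}
    (h : IsPullback i g f (Spec.map (CommRingCat.ofHom (Ideal.Quotient.mk I)))) [IsAffine Y] :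
    IsAffine X := by
  refine Ideal.IsNilpotent.induction_on I hI
    (P := fun S _ I ↦ ∀ {X Y : Scheme.{u}} {f : X ⟶ Spec (.of S)} {i : Y ⟶ X}
      {g : Y ⟶ Spec (.of (S ⧸ I))},
      IsPullback i g f (Spec.map (CommRingCat.ofHom (Ideal.Quotient.mk I))) →
      IsAffine Y → IsAffine X) ?_ ?_ h ‹_›
  · intro S _ I hI X Y f i g h _
    exact isAffine_of_isPullback_of_sq_eq_bot (R := .of S) hI h
  · intro S _ I J hIJ ih₁ ih₂ X Y f i g h hY
    let e : (S ⧸ I) ⧸ J.map (Ideal.Quotient.mk I) ≃+* S ⧸ J :=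
      (DoubleQuot.quotQuotEquivQuotSup I J).trans (Ideal.quotEquivOfEq (sup_eq_right.mpr hIJ))
    have h' : IsPullback i (g ≫ Spec.map (CommRingCat.ofHom e.toRingHom)) f
        (Spec.map (CommRingCat.ofHom (Ideal.Quotient.mk (J.map (Ideal.Quotient.mk I)))) ≫
          Spec.map (CommRingCat.ofHom (Ideal.Quotient.mk I))) := by
      refine h.of_iso (Iso.refl _) (Iso.refl _) (Scheme.Spec.mapIso e.toCommRingCatIso.op)
        (Iso.refl _) (by simp) ?_ (by simp) ?_
      · exact (Category.id_comp _).symm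
      · refine (Category.comp_id _).trans ?_
        rw [← Spec.map_comp]
        exact Spec.map_comp (CommRingCat.ofHom (Ideal.Quotient.mk I) ≫
          CommRingCat.ofHom (Ideal.Quotient.mk (J.map (Ideal.Quotient.mk I))))
          (CommRingCat.ofHom e.toRingHom)
    have hX := IsPullback.of_hasPullback f (Spec.map (CommRingCat.ofHom (Ideal.Quotient.mk I)))
    obtain ⟨j, hj, hj'⟩ := hX.exists_lift i _ (h'.w.trans (Category.assoc _ _ _).symm)
    exact ih₁ hX (ih₂ (.of_right (hj.symm ▸ h') hj' hX) hY)

/-- A scheme affine over `Spec R` is locally of finite type if its restriction to a closed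
subscheme of `Spec R` defined by a nilpotent ideal is. -/
theorem locallyOfFiniteType_of_isPullback_of_isNilpotent {R : CommRingCat.{u}} {I : Ideal R}
    (hI : IsNilpotent I) [IsAffine X] {f : X ⟶ Spec R} {i : Y ⟶ X}
    {g : Y ⟶ Spec (.of (R ⧸ I))}
    (h : IsPullback i g f (Spec.map (CommRingCat.ofHom (Ideal.Quotient.mk I))))
    [LocallyOfFiniteType g] : LocallyOfFiniteType f := by
  have : IsClosedImmersion (Spec.map (CommRingCat.ofHom (Ideal.Quotient.mk I))) :=
    .spec_of_surjective _ Ideal.Quotient.mk_surjective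
  have : IsClosedImmersion i := MorphismProperty.of_isPullback h.flip this
  have : IsAffine Y := isAffine_of_isAffineHom i
  have hft : LocallyOfFiniteType (i ≫ f) := h.w ▸ inferInstance
  obtain ⟨φ, hφ⟩ : ∃ φ, X.isoSpec.inv ≫ f = Spec.map φ := ⟨_, (Spec.map_preimage _).symm⟩
  have hcomp : Spec.map (φ ≫ i.appTop) = Y.isoSpec.inv ≫ i ≫ f := by
    rw [Spec.map_comp, ← hφ, Scheme.isoSpec_inv_naturality_assoc]
  have hcft : (φ ≫ i.appTop).hom.FiniteType := by
    rw [← HasRingHomProperty.Spec_iff (P := @LocallyOfFiniteType), hcomp]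
    infer_instance
  have hU := isAffineOpen_top X
  have hφft : φ.hom.FiniteType := .of_comp_of_ker_le_map (i.app_surjective _ hU) hI
    (hU.ker_app_le_map h (by rw [IsAffineOpen.fromSpec_top, hφ])) hcft
  rw [← HasRingHomProperty.Spec_iff (P := @LocallyOfFiniteType), ← hφ] at hφft
  rw [← X.isoSpec.hom_inv_id_assoc f]
  infer_instance

end AlgebraicGeometry

/-- Let `R` be a commutative ring and `I ⊆ R` a nilpotent ideal.  Let `X` be a scheme
over `Spec R` such that the closed subscheme `Y = X ×_{Spec R} Spec (R/I)` is affine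
and of finite type over `R/I`.  Then `X` is affine and of finite type over `R`. -/
theorem isAffine_and_finiteType_of_nilpotent_thickening
    (R : Type) [CommRing R] (I : Ideal R) (hInil : ∃ n : ℕ, 1 ≤ n ∧ I ^ n = ⊥)
    (X : Scheme) (f : X ⟶ Spec (CommRingCat.of R))
    (haff : IsAffine (pullback f
      (Spec.map (CommRingCat.ofHom (Ideal.Quotient.mk I)))))
    (hft : LocallyOfFiniteType (pullback.snd f
      (Spec.map (CommRingCat.ofHom (Ideal.Quotient.mk I))))) :
    IsAffine X ∧ LocallyOfFiniteType f := by
  have hI : IsNilpotent I := hInil.imp fun _ h ↦ h.2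
  have h := IsPullback.of_hasPullback f (Spec.map (CommRingCat.ofHom (Ideal.Quotient.mk I)))
  have := isAffine_of_isPullback_of_isNilpotent hI h
  exact ⟨this, locallyOfFiniteType_of_isPullback_of_isNilpotent (R := .of R) hI h⟩
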